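/- arXiv:2106.08923 — 2 statements merged into one kernel-verified Lean document; each statement's English description precedes it below -/
import Mathlib

section
/- Let d ≥ 1 and let t_1, …, t_n be distinct real numbers. Let q_i = (t_i, t_i^2) ∈ ℝ² be the corresponding points on the standard parabola and let w_i = (1, t_i, …, t_i^{d−1}) ∈ ℝ^d. Then for every set E of pairs {i,j} with 1 ≤ i < j ≤ n, the rows of the cofactor rigidity matrix C_d(q) indexed by E are linearly independent if and only if the rows of the hyperconnectivity matrix H(w) indexed by E are linearly independent. (That is, the C^{d−2}_{d−1}-cofactor matroid of points along the parabola equals the d-dimensional hyperconnectivity matroid of the vectors (1, t_i, …, t_i^{d−1}).) -/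
/-- The vector `c(x, y) = (x^{d-1}, x^{d-2}y, …, x y^{d-2}, y^{d-1})` used to define
cofactor rigidity. -/
def cofVec (d : ℕ) (x y : ℝ) : Fin d → ℝ :=
  fun k => x ^ (d - 1 - (k : ℕ)) * y ^ (k : ℕ)

/-- Row of the cofactor rigidity matrix `C_d(q)` indexed by the ordered pair `e = (i, j)`:
block `i` contains `c(qᵢ - qⱼ)`, block `j` contains `-c(qᵢ - qⱼ)`, other blocks are zero. -/
def cofRow {n : ℕ} (d : ℕ) (q : Fin n → ℝ × ℝ) (e : Fin n × Fin n) :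
    Fin n → Fin d → ℝ :=
  fun k =>
    if k = e.1 then cofVec d ((q e.1).1 - (q e.2).1) ((q e.1).2 - (q e.2).2)
    else if k = e.2 then -cofVec d ((q e.1).1 - (q e.2).1) ((q e.1).2 - (q e.2).2)
    else 0

/-- Row of the hyperconnectivity matrix indexed by the ordered pair `e = (i, j)`:
block `i` contains `w j`, block `j` contains `-w i`, other blocks are zero. -/
def hypRow {n d : ℕ} (w : Fin n → Fin d → ℝ) (e : Fin n × Fin n) :
    Fin n → Fin d → ℝ :=
  fun k => if k = e.1 then w e.2 else if k = e.2 then -w e.1 else 0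

/-- Moment vector. -/
def momVec (d : ℕ) (x : ℝ) : Fin d → ℝ := fun k => x ^ (k : ℕ)

/-- Translation matrix acting on moment vectors. -/
def transMat (d : ℕ) (a : ℝ) : Matrix (Fin d) (Fin d) ℝ :=
  fun k l => a ^ ((k : ℕ) - (l : ℕ)) * (Nat.choose k l : ℝ)

lemma transMat_mulVec (d : ℕ) (a x : ℝ) :
    (transMat d a).mulVec (momVec d x) = momVec d (x + a) := by
  funext k
  simp only [Matrix.mulVec, dotProduct, transMat, momVec]
  rw [Fin.sum_univ_eq_sum_range
    (fun l => a ^ ((k : ℕ) - l) * (Nat.choose k l : ℝ) * x ^ l) d, add_pow]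
  symm
  have hk : (k : ℕ) + 1 ≤ d := k.2
  rw [← Finset.sum_subset (Finset.range_subset_range.2 hk)]
  · refine Finset.sum_congr rfl fun l _ => by ring
  · intro l _ hl
    have : (k : ℕ) < l := by simpa using hl
    simp [Nat.choose_eq_zero_of_lt this]

/-- Blockwise translation. -/
noncomputable def blockTrans (n d : ℕ) (a : Fin n → ℝ) :
    (Fin n → Fin d → ℝ) →ₗ[ℝ] (Fin n → Fin d → ℝ) :=
  LinearMap.pi fun k => (transMat d (a k)).mulVecLin.comp (LinearMap.proj k)

lemma blockTrans_apply (n d : ℕ) (a : Fin n → ℝ) (x : Fin n → Fin d → ℝ) (k : Fin n) :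
    blockTrans n d a x k = (transMat d (a k)).mulVec (x k) := rfl

/-- Rescaled cofactor row. -/
def sumRow {n : ℕ} (d : ℕ) (t : Fin n → ℝ) (e : Fin n × Fin n) : Fin n → Fin d → ℝ :=
  fun k => if k = e.1 then momVec d (t e.1 + t e.2)
    else if k = e.2 then -momVec d (t e.1 + t e.2) else 0

lemma cofVec_eq (d : ℕ) (a b : ℝ) :
    cofVec d (a - b) (a ^ 2 - b ^ 2) = (a - b) ^ (d - 1) • momVec d (a + b) := by
  funext k
  have hk : d - 1 = (d - 1 - (k : ℕ)) + k := by have := k.2; omega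
  simp only [cofVec, momVec, Pi.smul_apply, smul_eq_mul]
  conv_rhs => rw [hk, pow_add]
  rw [show a ^ 2 - b ^ 2 = (a - b) * (a + b) by ring, mul_pow]
  ring

/-- For distinct reals `t₁, …, tₙ`, the `C^{d-2}_{d-1}`-cofactor matroid of the points
`qᵢ = (tᵢ, tᵢ²)` on the standard parabola coincides with the `d`-dimensional
hyperconnectivity matroid of the vectors `wᵢ = (1, tᵢ, …, tᵢ^{d-1})`. -/
theorem cofactor_parabola_eq_hyperconnectivity
    (d n : ℕ) (hd : 1 ≤ d) (t : Fin n → ℝ) (ht : Function.Injective t)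
    (q : Fin n → ℝ × ℝ) (hqdef : ∀ i, q i = (t i, t i ^ 2))
    (w : Fin n → Fin d → ℝ) (hw : ∀ i k, w i k = t i ^ (k : ℕ))
    (E : Set (Fin n × Fin n)) (hE : ∀ e ∈ E, e.1 < e.2) :
    LinearIndependent ℝ (fun e : E => cofRow d q e.1) ↔
      LinearIndependent ℝ (fun e : E => hypRow w e.1) := by
  have hw' : ∀ i, w i = momVec d (t i) := fun i => funext fun k => hw i k
  have hne : ∀ e : E, (t e.1.1 - t e.1.2) ^ (d - 1) ≠ 0 := fun e =>
    pow_ne_zero _ (sub_ne_zero.2 fun h => (hE e.1 e.2).ne (ht h))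
  have h1 : (fun e : E => cofRow d q e.1) =
      (fun e : E => Units.mk0 _ (hne e)) • (fun e : E => sumRow d t e.1) := by
    funext e k
    simp only [cofRow, sumRow, hqdef, cofVec_eq, Pi.smul_apply', Units.smul_def, Units.val_mk0,
      Pi.smul_apply]
    split_ifs <;> simp
  rw [h1, LinearIndependent.units_smul_iff]
  constructor
  · intro h
    refine LinearIndependent.of_comp (blockTrans n d t) ?_
    convert h using 1
    funext e k
    simp only [Function.comp, blockTrans_apply, hypRow, sumRow, hw']
    split_ifs with h1 h2
    · rw [transMat_mulVec, h1, add_comm]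
    · rw [Matrix.mulVec_neg, transMat_mulVec, h2]
    · simp
  · intro h
    refine LinearIndependent.of_comp (blockTrans n d (-t)) ?_
    convert h using 1
    funext e k
    simp only [Function.comp, blockTrans_apply, hypRow, sumRow, hw', Pi.neg_apply]
    split_ifs with h1 h2
    · rw [transMat_mulVec, h1]; congr 1; ring
    · rw [Matrix.mulVec_neg, transMat_mulVec, h2]; congr 2; ring
    · simp
end

section
/- Let V = X ⊔ Y be a finite vertex set with a bipartition and let E ⊆ X × Y be a set of edges of a bipartite graph. If there exist vectors q_i ∈ ℝ^d (i ∈ V) such that the rows of the hyperconnectivity matrix H(q) indexed by E are linearly independent, then there exist points p_i ∈ ℝ^d (i ∈ V) such that the rows of the bar-and-joint rigidity matrix R(p) indexed by E are linearly independent. (That is, restricted to bipartite graphs, the generic bar-and-joint rigidity matroid R_d(n) is freer than the generic hyperconnectivity matroid H_d(n).) -/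
/-- Row of the bar-and-joint rigidity matrix over a vertex type `V`, indexed by the
ordered pair `e = (i, j)`: block `i` contains `p i - p j`, block `j` contains
`p j - p i`, other blocks are zero. -/
def rigRowV {V : Type*} [DecidableEq V] {d : ℕ} (p : V → Fin d → ℝ) (e : V × V) :
    V → Fin d → ℝ :=
  fun k => if k = e.1 then p e.1 - p e.2 else if k = e.2 then p e.2 - p e.1 else 0

/-- Row of the hyperconnectivity matrix over a vertex type `V`, indexed by the ordered
pair `e = (i, j)`: block `i` contains `q j`, block `j` contains `-q i`, other blocks
are zero. -/
def hypRowV {V : Type*} [DecidableEq V] {d : ℕ} (q : V → Fin d → ℝ) (e : V × V) :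
    V → Fin d → ℝ :=
  fun k => if k = e.1 then q e.2 else if k = e.2 then -q e.1 else 0

/-- Adjusting the first coordinates: an independent configuration can be perturbed so that
all first coordinates are nonzero. -/
lemma hyp_exists_nonzero {n : ℕ} {X Y : Type*} [Fintype X] [Fintype Y] [DecidableEq X]
    [DecidableEq Y] (E : Set (X × Y)) (q : X ⊕ Y → Fin (n + 1) → ℝ)
    (hq : LinearIndependent ℝ (fun e : E => hypRowV q (Sum.inl e.1.1, Sum.inr e.1.2))) :
    ∃ q : X ⊕ Y → Fin (n + 1) → ℝ, (∀ v, q v 0 ≠ 0) ∧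
      LinearIndependent ℝ (fun e : E => hypRowV q (Sum.inl e.1.1, Sum.inr e.1.2)) := by
  classical
  let F : ℝ → E → (X ⊕ Y → Fin (n + 1) → ℝ) := fun t e =>
    hypRowV (fun v i => q v i + t) (Sum.inl e.1.1, Sum.inr e.1.2)
  have hF : Continuous F := by
    refine continuous_pi fun e => continuous_pi fun k => continuous_pi fun i => ?_
    simp only [F, hypRowV]
    split_ifs
    · fun_prop
    · simp only [Pi.neg_apply]
      fun_prop
    · fun_prop
  have hopen : IsOpen {t | LinearIndependent ℝ (F t)} :=
    isOpen_setOfPred_linearIndependent.preimage hF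
  have h0 : (0 : ℝ) ∈ {t | LinearIndependent ℝ (F t)} := by
    simpa [F] using hq
  have hinf : {t | LinearIndependent ℝ (F t)}.Infinite :=
    infinite_of_mem_nhds 0 (hopen.mem_nhds h0)
  obtain ⟨t, ht, ht'⟩ := hinf.exists_notMem_finite (Set.finite_range fun v => -(q v 0))
  refine ⟨fun v i => q v i + t, fun v hv => ht' ⟨v, ?_⟩, ht⟩
  simp only at hv ⊢
  linarith

/-- The block-wise invertible shear turning rigidity rows into hyperconnectivity rows. -/
noncomputable def shearMap {n : ℕ} {V : Type*} (q : V → Fin (n + 1) → ℝ) :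
    (V → Fin (n + 1) → ℝ) →ₗ[ℝ] (V → Fin (n + 1) → ℝ) where
  toFun g v i := (q v 0)⁻¹ * (g v i - if i = 0 then 0 else g v 0 * (q v i / q v 0))
  map_add' f g := by
    ext v i
    simp only [Pi.add_apply]
    split_ifs <;> ring
  map_smul' c g := by
    ext v i
    simp only [Pi.smul_apply, smul_eq_mul, RingHom.id_apply]
    split_ifs <;> ring

/-- Restricted to bipartite graphs, the generic bar-and-joint rigidity matroid is freer
than the generic hyperconnectivity matroid: if the edges `E ⊆ X × Y` are independent in
the hyperconnectivity matroid of some vectors `q`, then they are independent in the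
bar-and-joint rigidity matroid of some points `p`. -/
theorem bipartite_rigidity_freer_than_hyperconnectivity
    (d : ℕ) (X Y : Type*) [Fintype X] [Fintype Y] [DecidableEq X] [DecidableEq Y]
    (E : Set (X × Y))
    (h : ∃ q : X ⊕ Y → Fin d → ℝ,
      LinearIndependent ℝ (fun e : E => hypRowV q (Sum.inl e.1.1, Sum.inr e.1.2))) :
    ∃ p : X ⊕ Y → Fin d → ℝ,
      LinearIndependent ℝ (fun e : E => rigRowV p (Sum.inl e.1.1, Sum.inr e.1.2)) := by
  obtain ⟨q, hq⟩ := h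
  cases d with
  | zero =>
    refine ⟨q, ?_⟩
    convert hq
  | succ n =>
    obtain ⟨q, hne, hq⟩ := hyp_exists_nonzero E q hq
    let p : X ⊕ Y → Fin (n + 1) → ℝ := fun v i =>
      Sum.elim (fun x => if i = 0 then 1 else q (Sum.inl x) i / q (Sum.inl x) 0)
        (fun y => if i = 0 then 0 else -(q (Sum.inr y) i / q (Sum.inr y) 0)) v
    refine ⟨p, LinearIndependent.of_comp (shearMap q) ?_⟩
    let a : E → ℝˣ := fun e =>
      (Units.mk0 _ (hne (Sum.inl e.1.1)))⁻¹ * (Units.mk0 _ (hne (Sum.inr e.1.2)))⁻¹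
    convert hq.units_smul a using 1
    funext e
    obtain ⟨⟨x, y⟩, he⟩ := e
    have hx := hne (Sum.inl x)
    have hy := hne (Sum.inr y)
    funext v i
    simp only [Function.comp, shearMap, LinearMap.coe_mk, AddHom.coe_mk, rigRowV, hypRowV,
      Pi.smul_apply', Pi.smul_apply, Units.smul_def, a, Units.val_mul, Units.val_inv_eq_inv_val,
      Units.val_mk0, smul_eq_mul]
    by_cases h1 : v = Sum.inl x
    · subst h1
      by_cases hi : i = 0
      · subst hi
        simp [p]
        field_simp
      · simp [p, hi]
        field_simp
    · by_cases h2 : v = Sum.inr y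
      · subst h2
        by_cases hi : i = 0
        · subst hi
          simp [p]
          field_simp
        · simp [p, hi]
          field_simp
          try ring
      · simp [h1, h2]
end
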